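/- Let u be a classical solution with decay weight b of the Zakharov–Kuznetsov–Burgers problem on the strip S. Then for every t > 0: (d/dt)(e^{2bx}, u_{xx}²)(t) + (2 + 6b)(e^{2bx}, u_{xxx}²)(t) + 2b(e^{2bx}, u_{xxy}²)(t) − (4b² + 8b³)(e^{2bx}, u_{xx}²)(t) − 2b(e^{2bx}, u u_{xx}²)(t) + 5(e^{2bx}, u_x u_{xx}²)(t) = 0. -/

import Mathlib

open MeasureTheory Real Set

/-- The mixed partial derivative `∂_x^i ∂_y^j ∂_t^k u` of a function
`u = u(x, y, t)`, evaluated at `(x, y, t)`. -/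
noncomputable def pd (i j k : ℕ) (u : ℝ → ℝ → ℝ → ℝ) (x y t : ℝ) : ℝ :=
  iteratedDeriv i (fun x' => iteratedDeriv j (fun y' => iteratedDeriv k (u x' y') t) y) x

/-- The strip `S = ℝ × (0, B)`. -/
def strip (B : ℝ) : Set (ℝ × ℝ) := Set.univ ×ˢ Set.Ioo 0 B

/-- A classical solution, with decay weight `b`, of the Zakharov–Kuznetsov–Burgers
initial-boundary value problem on the strip `S = ℝ × (0, B)`:
a smooth function `u(x, y, t)` satisfying the ZKB equation
`u_t - u_xx + u u_x + u_xxx + u_xyy = 0` in `ℝ × (0,B) × (0,∞)`, the Dirichlet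
boundary conditions `u(x,0,t) = u(x,B,t) = 0`, and such that for every partial
derivative `∂^α u` of order `|α| ≤ 5` in `x, y, t`, both `|∂^α u|²` and
`e^{2bx} |∂^α u|²` are integrable over `S` for each `t ≥ 0`, with integrals
bounded uniformly for `t` in compact subsets of `[0, ∞)`, and
`(1 + e^{2bx}) |∂^α u(x,y,t)|² → 0` as `|x| → ∞`, uniformly in `y` and locally
uniformly in `t`. -/
structure IsZKBSolution (B b : ℝ) (u : ℝ → ℝ → ℝ → ℝ) : Prop where
  smooth : ContDiff ℝ (⊤ : ℕ∞) (fun p : ℝ × ℝ × ℝ => u p.1 p.2.1 p.2.2)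
  pde : ∀ x : ℝ, ∀ y ∈ Set.Ioo (0:ℝ) B, ∀ t : ℝ, 0 < t →
    pd 0 0 1 u x y t - pd 2 0 0 u x y t + u x y t * pd 1 0 0 u x y t
      + pd 3 0 0 u x y t + pd 1 2 0 u x y t = 0
  bdry0 : ∀ x t : ℝ, 0 ≤ t → u x 0 t = 0
  bdryB : ∀ x t : ℝ, 0 ≤ t → u x B t = 0
  integ : ∀ i j k : ℕ, i + j + k ≤ 5 → ∀ t : ℝ, 0 ≤ t →
    IntegrableOn (fun p : ℝ × ℝ => (1 + Real.exp (2*b*p.1)) * (pd i j k u p.1 p.2 t)^2)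
      (strip B) volume
  bdd : ∀ i j k : ℕ, i + j + k ≤ 5 → ∀ T : ℝ, ∃ M : ℝ, ∀ t ∈ Set.Icc (0:ℝ) T,
    (∫ p in strip B, (1 + Real.exp (2*b*p.1)) * (pd i j k u p.1 p.2 t)^2) ≤ M
  decay : ∀ i j k : ℕ, i + j + k ≤ 5 → ∀ T : ℝ, ∀ ε : ℝ, 0 < ε → ∃ R : ℝ,
    ∀ x : ℝ, R ≤ |x| → ∀ y ∈ Set.Icc (0:ℝ) B, ∀ t ∈ Set.Icc (0:ℝ) T,
      (1 + Real.exp (2*b*x)) * (pd i j k u x y t)^2 ≤ ε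

/-! ### Mixed partial derivatives of a smooth function -/

section PartialDerivatives

variable {E : Type*} [NormedAddCommGroup E] [NormedSpace ℝ E]

/-- The derivative of `f` in the direction `v`, as a function of the base point. -/
noncomputable def dirDeriv (v : E) (f : E → ℝ) (p : E) : ℝ := fderiv ℝ f p v

lemma ContDiff.dirDeriv {f : E → ℝ} (hf : ContDiff ℝ (⊤ : ℕ∞) f) (v : E) :
    ContDiff ℝ (⊤ : ℕ∞) (dirDeriv v f) :=
  (hf.fderiv_right (by simp)).clm_apply contDiff_const

lemma ContDiff.dirDeriv_iterate {f : E → ℝ} (hf : ContDiff ℝ (⊤ : ℕ∞) f) (v : E) (n : ℕ) :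
    ContDiff ℝ (⊤ : ℕ∞) ((_root_.dirDeriv v)^[n] f) := by
  induction n with
  | zero => exact hf
  | succ n ih =>
    rw [Function.iterate_succ_apply']
    exact ih.dirDeriv v

lemma dirDeriv_comm {f : E → ℝ} (hf : ContDiff ℝ (⊤ : ℕ∞) f) (v w : E) :
    dirDeriv v (dirDeriv w f) = dirDeriv w (dirDeriv v f) := by
  funext p
  have hd : DifferentiableAt ℝ (fderiv ℝ f) p :=
    ((hf.fderiv_right (m := (⊤ : ℕ∞)) (by simp)).differentiable (by simp)) p
  have key : ∀ a c : E, dirDeriv a (dirDeriv c f) p = fderiv ℝ (fderiv ℝ f) p a c := by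
    intro a c
    change fderiv ℝ (fun q => fderiv ℝ f q c) p a = _
    rw [fderiv_clm_apply hd (differentiableAt_const c)]
    simp
  rw [key, key]
  exact (hf.contDiffAt.isSymmSndFDerivAt
    (by rw [minSmoothness_of_isRCLikeNormedField]; exact WithTop.coe_le_coe.2 le_top)) v w

lemma dirDeriv_iterate_comm {f : E → ℝ} (hf : ContDiff ℝ (⊤ : ℕ∞) f) (v w : E) (n : ℕ) :
    (dirDeriv v)^[n] (dirDeriv w f) = dirDeriv w ((dirDeriv v)^[n] f) := by
  induction n with
  | zero => rfl
  | succ n ih =>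
    rw [Function.iterate_succ_apply', ih, Function.iterate_succ_apply',
      dirDeriv_comm (hf.dirDeriv_iterate v n)]

lemma hasDerivAt_comp_dirDeriv {f : E → ℝ} (hf : ContDiff ℝ (⊤ : ℕ∞) f) {c : ℝ → E} {v : E}
    {s : ℝ} (hc : HasDerivAt c v s) : HasDerivAt (fun r => f (c r)) (dirDeriv v f (c s)) s :=
  ((hf.differentiable (by simp)) (c s)).hasFDerivAt.comp_hasDerivAt s hc

lemma iteratedDeriv_comp_eq_dirDeriv {f : E → ℝ} (hf : ContDiff ℝ (⊤ : ℕ∞) f) {c : ℝ → E} {v : E}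
    (hc : ∀ s, HasDerivAt c v s) (n : ℕ) :
    iteratedDeriv n (fun r => f (c r)) = fun r => (dirDeriv v)^[n] f (c r) := by
  induction n with
  | zero => simp
  | succ n ih =>
    rw [iteratedDeriv_succ, ih]
    funext s
    rw [Function.iterate_succ_apply']
    exact (hasDerivAt_comp_dirDeriv (hf.dirDeriv_iterate v n) (hc s)).deriv

lemma hasDerivAt_line_x (y t s : ℝ) :
    HasDerivAt (fun r : ℝ => ((r, y, t) : ℝ × ℝ × ℝ)) (1, 0, 0) s :=
  (hasDerivAt_id s).prodMk (hasDerivAt_const s (y, t))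

lemma hasDerivAt_line_y (x t s : ℝ) :
    HasDerivAt (fun r : ℝ => ((x, r, t) : ℝ × ℝ × ℝ)) (0, 1, 0) s :=
  (hasDerivAt_const s x).prodMk ((hasDerivAt_id s).prodMk (hasDerivAt_const s t))

lemma hasDerivAt_line_t (x y s : ℝ) :
    HasDerivAt (fun r : ℝ => ((x, y, r) : ℝ × ℝ × ℝ)) (0, 0, 1) s :=
  (hasDerivAt_const s x).prodMk ((hasDerivAt_const s y).prodMk (hasDerivAt_id s))

variable {u : ℝ → ℝ → ℝ → ℝ}

lemma pd_eq_dirDeriv (hu : ContDiff ℝ (⊤ : ℕ∞) (fun p : ℝ × ℝ × ℝ => u p.1 p.2.1 p.2.2))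
    (i j k : ℕ) (x y t : ℝ) :
    pd i j k u x y t = (dirDeriv (1, 0, 0))^[i] ((dirDeriv (0, 1, 0))^[j]
      ((dirDeriv (0, 0, 1))^[k] (fun p : ℝ × ℝ × ℝ => u p.1 p.2.1 p.2.2))) (x, y, t) := by
  have h1 : ∀ x' y', iteratedDeriv k (u x' y') t = (dirDeriv (0, 0, 1))^[k]
      (fun p : ℝ × ℝ × ℝ => u p.1 p.2.1 p.2.2) (x', y', t) := fun x' y' =>
    congrFun (iteratedDeriv_comp_eq_dirDeriv hu (hasDerivAt_line_t x' y') k) t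
  have hk := hu.dirDeriv_iterate (0, 0, 1) k
  have h2 := fun x' => congrFun (iteratedDeriv_comp_eq_dirDeriv hk (hasDerivAt_line_y x' t) j) y
  have hj := hk.dirDeriv_iterate (0, 1, 0) j
  have h3 := congrFun (iteratedDeriv_comp_eq_dirDeriv hj (hasDerivAt_line_x y t) i) x
  simp only [pd, h1, h2, h3]

lemma contDiff_pd (hu : ContDiff ℝ (⊤ : ℕ∞) (fun p : ℝ × ℝ × ℝ => u p.1 p.2.1 p.2.2))
    (i j k : ℕ) : ContDiff ℝ (⊤ : ℕ∞) (fun p : ℝ × ℝ × ℝ => pd i j k u p.1 p.2.1 p.2.2) := by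
  simp only [pd_eq_dirDeriv hu]
  exact ((hu.dirDeriv_iterate _ k).dirDeriv_iterate _ j).dirDeriv_iterate _ i

lemma hasDerivAt_pd_x (hu : ContDiff ℝ (⊤ : ℕ∞) (fun p : ℝ × ℝ × ℝ => u p.1 p.2.1 p.2.2))
    (i j k : ℕ) (x y t : ℝ) :
    HasDerivAt (fun s => pd i j k u s y t) (pd (i + 1) j k u x y t) x := by
  simp only [pd_eq_dirDeriv hu, Function.iterate_succ_apply']
  exact hasDerivAt_comp_dirDeriv
    (((hu.dirDeriv_iterate _ k).dirDeriv_iterate _ j).dirDeriv_iterate _ i)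
    (hasDerivAt_line_x y t x)

lemma hasDerivAt_pd_y (hu : ContDiff ℝ (⊤ : ℕ∞) (fun p : ℝ × ℝ × ℝ => u p.1 p.2.1 p.2.2))
    (i j k : ℕ) (x y t : ℝ) :
    HasDerivAt (fun s => pd i j k u x s t) (pd i (j + 1) k u x y t) y := by
  have hk := hu.dirDeriv_iterate (0, 0, 1) k
  have hj := hk.dirDeriv_iterate (0, 1, 0) j
  simp only [pd_eq_dirDeriv hu, Function.iterate_succ_apply', dirDeriv_iterate_comm hj]
  exact hasDerivAt_comp_dirDeriv (hj.dirDeriv_iterate _ i) (hasDerivAt_line_y x t y)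

lemma hasDerivAt_pd_t (hu : ContDiff ℝ (⊤ : ℕ∞) (fun p : ℝ × ℝ × ℝ => u p.1 p.2.1 p.2.2))
    (i j k : ℕ) (x y t : ℝ) :
    HasDerivAt (fun s => pd i j k u x y s) (pd i j (k + 1) u x y t) t := by
  have hk := hu.dirDeriv_iterate (0, 0, 1) k
  have hj := hk.dirDeriv_iterate (0, 1, 0) j
  simp only [pd_eq_dirDeriv hu, Function.iterate_succ_apply', dirDeriv_iterate_comm hk,
    dirDeriv_iterate_comm hj]
  exact hasDerivAt_comp_dirDeriv (hj.dirDeriv_iterate _ i) (hasDerivAt_line_t x y t)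

end PartialDerivatives

/-! ### Differentiation of a parametric integral without a dominating function -/

section ParametricIntegral

variable {α : Type*} [MeasurableSpace α] {μ : Measure α} [SFinite μ] {T M : ℝ}

/-- If the `L¹`-norm of the parameter derivative is bounded, the integral is the primitive of
the integral of the parameter derivative. -/
lemma integral_sub_integral_eq_intervalIntegral {g g' : ℝ → α → ℝ}
    (hmeas : StronglyMeasurable (Function.uncurry g'))
    (hderiv : ∀ τ p, HasDerivAt (fun s => g s p) (g' τ p) τ)
    (hcont : ∀ p, Continuous fun s => g' s p)
    (hg : ∀ τ ∈ Icc 0 T, Integrable (g τ) μ) (hg' : ∀ τ ∈ Icc 0 T, Integrable (g' τ) μ)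
    (hM : ∀ τ ∈ Icc 0 T, ∫ p, |g' τ p| ∂μ ≤ M) {s τ : ℝ} (hs : s ∈ Icc 0 T)
    (hτ : τ ∈ Icc 0 T) :
    ∫ p, g τ p ∂μ - ∫ p, g s p ∂μ = ∫ r in s..τ, ∫ p, g' r p ∂μ := by
  have hsub : uIoc s τ ⊆ Icc 0 T := uIoc_subset_uIcc.trans (uIcc_subset_Icc hs hτ)
  have hint : Integrable (Function.uncurry g') ((volume.restrict (uIoc s τ)).prod μ) := by
    rw [integrable_prod_iff hmeas.aestronglyMeasurable]
    refine ⟨(ae_restrict_iff' measurableSet_uIoc).2 (ae_of_all _ fun r hr => hg' r (hsub hr)), ?_⟩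
    have : IsFiniteMeasure (volume.restrict (uIoc s τ)) := by
      unfold uIoc
      infer_instance
    refine Integrable.of_bound (C := M)
      hmeas.aestronglyMeasurable.norm.integral_prod_right' ?_
    refine (ae_restrict_iff' measurableSet_uIoc).2 (ae_of_all _ fun r hr => ?_)
    rw [Real.norm_of_nonneg (integral_nonneg fun _ => norm_nonneg _)]
    exact hM r (hsub hr)
  rw [intervalIntegral_integral_swap hint, ← integral_sub (hg τ hτ) (hg s hs)]
  refine integral_congr_ae (ae_of_all _ fun p => ?_)
  exact (intervalIntegral.integral_eq_sub_of_hasDerivAt (fun r _ => hderiv r p)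
    ((hcont p).intervalIntegrable _ _)).symm

/-- Differentiation under the integral sign when the first two parameter derivatives are bounded
in `L¹`, locally uniformly in the parameter. -/
lemma hasDerivAt_integral_of_integral_abs_le {g g' g'' : ℝ → α → ℝ}
    (hmeas' : StronglyMeasurable (Function.uncurry g'))
    (hmeas'' : StronglyMeasurable (Function.uncurry g''))
    (hderiv : ∀ τ p, HasDerivAt (fun s => g s p) (g' τ p) τ)
    (hderiv' : ∀ τ p, HasDerivAt (fun s => g' s p) (g'' τ p) τ)
    (hcont'' : ∀ p, Continuous fun s => g'' s p)
    (hg : ∀ τ ∈ Icc 0 T, Integrable (g τ) μ) (hg' : ∀ τ ∈ Icc 0 T, Integrable (g' τ) μ)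
    (hg'' : ∀ τ ∈ Icc 0 T, Integrable (g'' τ) μ)
    (hM' : ∀ τ ∈ Icc 0 T, ∫ p, |g' τ p| ∂μ ≤ M)
    (hM'' : ∀ τ ∈ Icc 0 T, ∫ p, |g'' τ p| ∂μ ≤ M) {t : ℝ} (ht : t ∈ Ioo 0 T) :
    HasDerivAt (fun τ => ∫ p, g τ p ∂μ) (∫ p, g' t p ∂μ) t := by
  have htT : t ∈ Icc 0 T := Ioo_subset_Icc_self ht
  have h0 : (0 : ℝ) ∈ Icc 0 T := ⟨le_rfl, htT.1.trans htT.2⟩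
  have hcont' : ∀ p, Continuous fun s => g' s p := fun p =>
    continuous_iff_continuousAt.2 fun τ => (hderiv' τ p).continuousAt
  have hlip : LipschitzOnWith M.toNNReal (fun τ => ∫ p, g' τ p ∂μ) (Icc 0 T) := by
    refine LipschitzOnWith.of_dist_le_mul fun τ hτ s hs => ?_
    rw [Real.dist_eq, Real.dist_eq,
      integral_sub_integral_eq_intervalIntegral hmeas'' hderiv' hcont'' hg' hg'' hM'' hs hτ,
      ← Real.norm_eq_abs]
    refine intervalIntegral.norm_integral_le_of_norm_le_const fun r hr => ?_
    have hr' : r ∈ Icc 0 T := uIcc_subset_Icc hs hτ (uIoc_subset_uIcc hr)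
    exact (norm_integral_le_integral_norm _).trans ((hM'' r hr').trans (Real.le_coe_toNNReal M))
  have hprim : HasDerivAt (fun τ => ∫ p, g 0 p ∂μ + ∫ r in (0 : ℝ)..τ, ∫ p, g' r p ∂μ)
      (∫ p, g' t p ∂μ) t := by
    refine HasDerivAt.const_add _ (intervalIntegral.integral_hasDerivAt_right ?_ ?_ ?_)
    · refine (hlip.continuousOn.mono ?_).intervalIntegrable
      exact uIcc_subset_Icc h0 htT
    · exact (hlip.continuousOn.mono Ioo_subset_Icc_self).stronglyMeasurableAtFilter
        isOpen_Ioo t ht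
    · exact hlip.continuousOn.continuousAt (Icc_mem_nhds ht.1 ht.2)
  refine hprim.congr_of_eventuallyEq ?_
  filter_upwards [Icc_mem_nhds ht.1 ht.2] with τ hτ
  rw [← integral_sub_integral_eq_intervalIntegral hmeas' hderiv hcont' hg hg' hM' h0 hτ]
  ring

end ParametricIntegral

/-! ### Integrals of derivatives over the strip -/

lemma volume_restrict_strip (B : ℝ) :
    (volume : Measure (ℝ × ℝ)).restrict (strip B)
      = (volume : Measure ℝ).prod (volume.restrict (Ioo 0 B)) := by
  rw [strip, Measure.volume_eq_prod, ← Measure.prod_restrict, Measure.restrict_univ]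

lemma measurableSet_strip (B : ℝ) : MeasurableSet (strip B) :=
  MeasurableSet.univ.prod measurableSet_Ioo

lemma integral_strip_deriv_x_eq_zero {B : ℝ} {F F' : ℝ → ℝ → ℝ}
    (hderiv : ∀ x y, HasDerivAt (fun s => F s y) (F' x y) x)
    (hF : IntegrableOn (fun p : ℝ × ℝ => F p.1 p.2) (strip B))
    (hF' : IntegrableOn (fun p : ℝ × ℝ => F' p.1 p.2) (strip B)) :
    ∫ p in strip B, F' p.1 p.2 = 0 := by
  rw [IntegrableOn, volume_restrict_strip] at hF hF'
  rw [volume_restrict_strip, integral_prod_symm _ hF']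
  refine integral_eq_zero_of_ae ?_
  filter_upwards [hF.prod_left_ae, hF'.prod_left_ae] with y hy hy'
  exact integral_eq_zero_of_hasDerivAt_of_integrable (fun x => hderiv x y) hy' hy

lemma integral_strip_deriv_y_eq_zero {B : ℝ} (hB : 0 < B) {F F' : ℝ → ℝ → ℝ}
    (hderiv : ∀ x y, HasDerivAt (fun s => F x s) (F' x y) y)
    (hcont : ∀ x, Continuous (F' x)) (h0 : ∀ x, F x 0 = 0) (h1 : ∀ x, F x B = 0)
    (hF' : IntegrableOn (fun p : ℝ × ℝ => F' p.1 p.2) (strip B)) :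
    ∫ p in strip B, F' p.1 p.2 = 0 := by
  rw [IntegrableOn, volume_restrict_strip] at hF'
  rw [volume_restrict_strip, integral_prod _ hF']
  refine integral_eq_zero_of_ae (ae_of_all _ fun x => ?_)
  change ∫ y in Ioo 0 B, F' x y = 0
  rw [← integral_Ioc_eq_integral_Ioo, ← intervalIntegral.integral_of_le hB.le,
    intervalIntegral.integral_eq_sub_of_hasDerivAt (fun y _ => hderiv x y)
      ((hcont x).intervalIntegrable _ _), h0, h1, sub_zero]

/-! ### Weighted products of derivatives of a solution -/

namespace IsZKBSolution

variable {B b : ℝ} {u : ℝ → ℝ → ℝ → ℝ}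

lemma continuous_pd (hu : IsZKBSolution B b u) (i j k : ℕ) :
    Continuous (fun p : ℝ × ℝ × ℝ => pd i j k u p.1 p.2.1 p.2.2) :=
  (contDiff_pd hu.smooth i j k).continuous

lemma continuous_pd_slice (hu : IsZKBSolution B b u) (i j k : ℕ) (t : ℝ) :
    Continuous (fun p : ℝ × ℝ => pd i j k u p.1 p.2 t) :=
  (hu.continuous_pd i j k).comp
    (continuous_fst.prodMk (continuous_snd.prodMk continuous_const))

lemma abs_weighted_mul_le (x f g : ℝ) :
    |exp (2 * b * x) * (f * g)| ≤
      (1 + exp (2 * b * x)) * f ^ 2 + (1 + exp (2 * b * x)) * g ^ 2 := by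
  have he := exp_pos (2 * b * x)
  have hfg : |f * g| ≤ f ^ 2 + g ^ 2 := by
    rw [abs_le]
    constructor <;> nlinarith [sq_nonneg (f + g), sq_nonneg (f - g), sq_nonneg f, sq_nonneg g]
  rw [abs_mul, abs_of_pos he, ← mul_add]
  exact mul_le_mul (by linarith) hfg (abs_nonneg _) (by linarith)

lemma integrableOn_weighted_mul (hu : IsZKBSolution B b u) {i j k i' j' k' : ℕ}
    (h : i + j + k ≤ 5) (h' : i' + j' + k' ≤ 5) {t : ℝ} (ht : 0 ≤ t) :
    IntegrableOn (fun p : ℝ × ℝ => exp (2 * b * p.1) *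
      (pd i j k u p.1 p.2 t * pd i' j' k' u p.1 p.2 t)) (strip B) := by
  refine ((hu.integ i j k h t ht).add (hu.integ i' j' k' h' t ht)).mono' ?_
    (ae_of_all _ fun p => abs_weighted_mul_le _ _ _)
  have h1 := hu.continuous_pd_slice i j k t
  have h2 := hu.continuous_pd_slice i' j' k' t
  exact Continuous.aestronglyMeasurable (by fun_prop)

lemma exists_integral_abs_weighted_mul_le (hu : IsZKBSolution B b u) {i j k i' j' k' : ℕ}
    (h : i + j + k ≤ 5) (h' : i' + j' + k' ≤ 5) (T : ℝ) :
    ∃ M : ℝ, ∀ t ∈ Icc 0 T, ∫ p in strip B, |exp (2 * b * p.1) *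
      (pd i j k u p.1 p.2 t * pd i' j' k' u p.1 p.2 t)| ≤ M := by
  obtain ⟨M, hM⟩ := hu.bdd i j k h T
  obtain ⟨M', hM'⟩ := hu.bdd i' j' k' h' T
  refine ⟨M + M', fun t ht => ?_⟩
  have h1 := hu.integ i j k h t ht.1
  have h2 := hu.integ i' j' k' h' t ht.1
  calc ∫ p in strip B, |exp (2 * b * p.1) * (pd i j k u p.1 p.2 t * pd i' j' k' u p.1 p.2 t)|
      ≤ ∫ p in strip B, ((1 + exp (2 * b * p.1)) * pd i j k u p.1 p.2 t ^ 2
          + (1 + exp (2 * b * p.1)) * pd i' j' k' u p.1 p.2 t ^ 2) :=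
        integral_mono (hu.integrableOn_weighted_mul h h' ht.1).abs (h1.fun_add h2)
          fun p => abs_weighted_mul_le _ _ _
    _ ≤ M + M' := by
        rw [integral_add h1 h2]
        exact add_le_add (hM t ht) (hM' t ht)

lemma exists_abs_pd_le (hu : IsZKBSolution B b u) {i j k : ℕ} (h : i + j + k ≤ 5) {t : ℝ}
    (ht : 0 ≤ t) : ∃ C : ℝ, ∀ p ∈ strip B, |pd i j k u p.1 p.2 t| ≤ C := by
  obtain ⟨R, hR⟩ := hu.decay i j k h t 1 one_pos
  obtain ⟨C, hC⟩ := ((isCompact_Icc (a := -R) (b := R)).prod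
    (isCompact_Icc (a := (0 : ℝ)) (b := B))).exists_bound_of_continuousOn
      (hu.continuous_pd_slice i j k t).continuousOn
  refine ⟨max C 1, fun p hp => ?_⟩
  have hy : p.2 ∈ Icc 0 B := Ioo_subset_Icc_self hp.2
  rcases le_total R |p.1| with hx | hx
  · refine le_max_of_le_right ((sq_le_one_iff_abs_le_one _).1 ?_)
    have := hR p.1 hx p.2 hy t ⟨ht, le_rfl⟩
    nlinarith [exp_pos (2 * b * p.1), sq_nonneg (pd i j k u p.1 p.2 t),
      mul_nonneg (exp_pos (2 * b * p.1)).le (sq_nonneg (pd i j k u p.1 p.2 t))]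
  · exact le_max_of_le_left (hC p ⟨abs_le.1 hx, hy⟩)

lemma integrableOn_weighted_mul_mul (hu : IsZKBSolution B b u) {l m n i j k i' j' k' : ℕ}
    (hw : l + m + n ≤ 5) (h : i + j + k ≤ 5) (h' : i' + j' + k' ≤ 5) {t : ℝ} (ht : 0 ≤ t) :
    IntegrableOn (fun p : ℝ × ℝ => pd l m n u p.1 p.2 t * (exp (2 * b * p.1) *
      (pd i j k u p.1 p.2 t * pd i' j' k' u p.1 p.2 t))) (strip B) := by
  obtain ⟨C, hC⟩ := hu.exists_abs_pd_le hw ht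
  exact (hu.integrableOn_weighted_mul h h' ht).bdd_mul
    (hu.continuous_pd_slice l m n t).aestronglyMeasurable
    ((ae_restrict_iff' (measurableSet_strip B)).2 (ae_of_all _ hC))

lemma hasDerivAt_weight (b x : ℝ) :
    HasDerivAt (fun s => exp (2 * b * s)) (2 * b * exp (2 * b * x)) x := by
  have := ((hasDerivAt_id x).const_mul (2 * b)).exp
  simpa [mul_comm] using this

/-- Integration by parts in `x` for a weighted product of two derivatives of `u`. -/
lemma integral_weighted_mul_by_parts_x (hu : IsZKBSolution B b u) {i j k i' j' k' : ℕ}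
    (h : i + j + k ≤ 4) (h' : i' + j' + k' ≤ 4) {t : ℝ} (ht : 0 ≤ t) :
    (∫ p in strip B, exp (2 * b * p.1) *
        (pd (i + 1) j k u p.1 p.2 t * pd i' j' k' u p.1 p.2 t))
      + (∫ p in strip B, exp (2 * b * p.1) *
        (pd i j k u p.1 p.2 t * pd (i' + 1) j' k' u p.1 p.2 t))
      + 2 * b * (∫ p in strip B, exp (2 * b * p.1) *
        (pd i j k u p.1 p.2 t * pd i' j' k' u p.1 p.2 t)) = 0 := by
  have i1 := hu.integrableOn_weighted_mul (i := i + 1) (j := j) (k := k) (i' := i') (j' := j')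
    (k' := k') (by omega) (by omega) ht
  have i2 := hu.integrableOn_weighted_mul (i := i) (j := j) (k := k) (i' := i' + 1) (j' := j')
    (k' := k') (by omega) (by omega) ht
  have i3 := hu.integrableOn_weighted_mul (i := i) (j := j) (k := k) (i' := i') (j' := j')
    (k' := k') (by omega) (by omega) ht
  rw [← integral_add i1 i2, ← integral_const_mul, ← integral_add (i1.fun_add i2) (i3.const_mul _)]
  refine integral_strip_deriv_x_eq_zero (F := fun x y => exp (2 * b * x) *
    (pd i j k u x y t * pd i' j' k' u x y t)) (F' := fun x y => exp (2 * b * x) *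
    (pd (i + 1) j k u x y t * pd i' j' k' u x y t) + exp (2 * b * x) *
    (pd i j k u x y t * pd (i' + 1) j' k' u x y t) + 2 * b * (exp (2 * b * x) *
    (pd i j k u x y t * pd i' j' k' u x y t))) (fun x y => ?_) i3
    ((i1.fun_add i2).add (i3.const_mul _))
  refine ((hasDerivAt_weight b x).mul ((hasDerivAt_pd_x hu.smooth i j k x y t).mul
    (hasDerivAt_pd_x hu.smooth i' j' k' x y t))).congr_deriv ?_
  simp only [Pi.mul_apply]
  ring

/-- Integration by parts in `x` for a weighted product of three derivatives of `u`. -/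
lemma integral_weighted_mul_mul_by_parts_x (hu : IsZKBSolution B b u)
    {l m n i j k i' j' k' : ℕ} (hw : l + m + n ≤ 4) (h : i + j + k ≤ 4) (h' : i' + j' + k' ≤ 4)
    {t : ℝ} (ht : 0 ≤ t) :
    (∫ p in strip B, pd (l + 1) m n u p.1 p.2 t * (exp (2 * b * p.1) *
        (pd i j k u p.1 p.2 t * pd i' j' k' u p.1 p.2 t)))
      + (∫ p in strip B, pd l m n u p.1 p.2 t * (exp (2 * b * p.1) *
        (pd (i + 1) j k u p.1 p.2 t * pd i' j' k' u p.1 p.2 t)))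
      + (∫ p in strip B, pd l m n u p.1 p.2 t * (exp (2 * b * p.1) *
        (pd i j k u p.1 p.2 t * pd (i' + 1) j' k' u p.1 p.2 t)))
      + 2 * b * (∫ p in strip B, pd l m n u p.1 p.2 t * (exp (2 * b * p.1) *
        (pd i j k u p.1 p.2 t * pd i' j' k' u p.1 p.2 t))) = 0 := by
  have i0 := hu.integrableOn_weighted_mul_mul (l := l + 1) (m := m) (n := n) (i := i) (j := j)
    (k := k) (i' := i') (j' := j') (k' := k') (by omega) (by omega) (by omega) ht
  have i1 := hu.integrableOn_weighted_mul_mul (l := l) (m := m) (n := n) (i := i + 1) (j := j)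
    (k := k) (i' := i') (j' := j') (k' := k') (by omega) (by omega) (by omega) ht
  have i2 := hu.integrableOn_weighted_mul_mul (l := l) (m := m) (n := n) (i := i) (j := j)
    (k := k) (i' := i' + 1) (j' := j') (k' := k') (by omega) (by omega) (by omega) ht
  have i3 := hu.integrableOn_weighted_mul_mul (l := l) (m := m) (n := n) (i := i) (j := j)
    (k := k) (i' := i') (j' := j') (k' := k') (by omega) (by omega) (by omega) ht
  rw [← integral_add i0 i1, ← integral_add (i0.fun_add i1) i2, ← integral_const_mul,
    ← integral_add ((i0.fun_add i1).fun_add i2) (i3.const_mul _)]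
  refine integral_strip_deriv_x_eq_zero (F := fun x y => pd l m n u x y t * (exp (2 * b * x) *
    (pd i j k u x y t * pd i' j' k' u x y t))) (F' := fun x y =>
    pd (l + 1) m n u x y t * (exp (2 * b * x) * (pd i j k u x y t * pd i' j' k' u x y t))
    + pd l m n u x y t * (exp (2 * b * x) * (pd (i + 1) j k u x y t * pd i' j' k' u x y t))
    + pd l m n u x y t * (exp (2 * b * x) * (pd i j k u x y t * pd (i' + 1) j' k' u x y t))
    + 2 * b * (pd l m n u x y t * (exp (2 * b * x) *
      (pd i j k u x y t * pd i' j' k' u x y t)))) (fun x y => ?_) i3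
    (((i0.fun_add i1).fun_add i2).add (i3.const_mul _))
  refine ((hasDerivAt_pd_x hu.smooth l m n x y t).mul ((hasDerivAt_weight b x).mul
    ((hasDerivAt_pd_x hu.smooth i j k x y t).mul
      (hasDerivAt_pd_x hu.smooth i' j' k' x y t)))).congr_deriv ?_
  simp only [Pi.mul_apply]
  ring

lemma pd_eq_zero_of_boundary {y t : ℝ} (h : ∀ x, u x y t = 0) (i : ℕ) (x : ℝ) :
    pd i 0 0 u x y t = 0 := by
  simp [pd, h]

/-- Integration by parts in `y` for a weighted product of two derivatives of `u`, the first of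
which vanishes on the boundary of the strip. -/
lemma integral_weighted_mul_by_parts_y (hu : IsZKBSolution B b u) (hB : 0 < B)
    {i i' j' k' : ℕ} (h : i ≤ 4) (h' : i' + j' + k' ≤ 4) {t : ℝ} (ht : 0 ≤ t) :
    (∫ p in strip B, exp (2 * b * p.1) *
        (pd i 1 0 u p.1 p.2 t * pd i' j' k' u p.1 p.2 t))
      + (∫ p in strip B, exp (2 * b * p.1) *
        (pd i 0 0 u p.1 p.2 t * pd i' (j' + 1) k' u p.1 p.2 t)) = 0 := by
  have i1 := hu.integrableOn_weighted_mul (i := i) (j := 1) (k := 0) (i' := i') (j' := j')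
    (k' := k') (by omega) (by omega) ht
  have i2 := hu.integrableOn_weighted_mul (i := i) (j := 0) (k := 0) (i' := i') (j' := j' + 1)
    (k' := k') (by omega) (by omega) ht
  rw [← integral_add i1 i2]
  refine integral_strip_deriv_y_eq_zero hB (F := fun x y => exp (2 * b * x) *
    (pd i 0 0 u x y t * pd i' j' k' u x y t)) (F' := fun x y => exp (2 * b * x) *
    (pd i 1 0 u x y t * pd i' j' k' u x y t) + exp (2 * b * x) *
    (pd i 0 0 u x y t * pd i' (j' + 1) k' u x y t)) (fun x y => ?_) (fun x => ?_) (fun x => ?_)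
    (fun x => ?_) (i1.fun_add i2)
  · refine (((hasDerivAt_pd_y hu.smooth i 0 0 x y t).mul
      (hasDerivAt_pd_y hu.smooth i' j' k' x y t)).const_mul (exp (2 * b * x))).congr_deriv ?_
    ring
  · have hc : ∀ i j k, Continuous fun y => pd i j k u x y t := fun i j k =>
      (hu.continuous_pd_slice i j k t).comp (Continuous.prodMk_right x)
    have := hc i 1 0
    have := hc i 0 0
    have := hc i' j' k'
    have := hc i' (j' + 1) k'
    fun_prop
  · simp [pd_eq_zero_of_boundary (fun x => hu.bdry0 x t ht)]
  · simp [pd_eq_zero_of_boundary (fun x => hu.bdryB x t ht)]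

lemma hasDerivAt_integral_weighted_sq (hu : IsZKBSolution B b u) {i j k : ℕ}
    (h : i + j + k ≤ 3) {t : ℝ} (ht : 0 < t) :
    HasDerivAt (fun τ => ∫ p in strip B, exp (2 * b * p.1) * (pd i j k u p.1 p.2 τ) ^ 2)
      (2 * ∫ p in strip B, exp (2 * b * p.1) *
        (pd i j k u p.1 p.2 t * pd i j (k + 1) u p.1 p.2 t)) t := by
  have hT : t ∈ Ioo 0 (t + 1) := ⟨ht, by linarith⟩
  obtain ⟨M₁, hM₁⟩ := hu.exists_integral_abs_weighted_mul_le (i := i) (j := j) (k := k)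
    (i' := i) (j' := j) (k' := k + 1) (by omega) (by omega) (t + 1)
  obtain ⟨M₂, hM₂⟩ := hu.exists_integral_abs_weighted_mul_le (i := i) (j := j) (k := k + 1)
    (i' := i) (j' := j) (k' := k + 1) (by omega) (by omega) (t + 1)
  obtain ⟨M₃, hM₃⟩ := hu.exists_integral_abs_weighted_mul_le (i := i) (j := j) (k := k)
    (i' := i) (j' := j) (k' := k + 2) (by omega) (by omega) (t + 1)
  have i0 := fun τ (hτ : τ ∈ Icc 0 (t + 1)) => hu.integrableOn_weighted_mul (i := i) (j := j)
    (k := k) (i' := i) (j' := j) (k' := k) (by omega) (by omega) hτ.1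
  have i1 := fun τ (hτ : τ ∈ Icc 0 (t + 1)) => hu.integrableOn_weighted_mul (i := i) (j := j)
    (k := k) (i' := i) (j' := j) (k' := k + 1) (by omega) (by omega) hτ.1
  have i2 := fun τ (hτ : τ ∈ Icc 0 (t + 1)) => hu.integrableOn_weighted_mul (i := i) (j := j)
    (k := k + 1) (i' := i) (j' := j) (k' := k + 1) (by omega) (by omega) hτ.1
  have i3 := fun τ (hτ : τ ∈ Icc 0 (t + 1)) => hu.integrableOn_weighted_mul (i := i) (j := j)
    (k := k) (i' := i) (j' := j) (k' := k + 2) (by omega) (by omega) hτ.1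
  have hc : ∀ k, Continuous fun q : ℝ × ℝ × ℝ => pd i j k u q.2.1 q.2.2 q.1 := fun k =>
    (hu.continuous_pd i j k).comp (by fun_prop : Continuous fun q : ℝ × ℝ × ℝ =>
      (q.2.1, q.2.2, q.1))
  have c0 := hc k
  have c1 := hc (k + 1)
  have c2 := hc (k + 2)
  have hc'' : Continuous fun q : ℝ × ℝ × ℝ => 2 * (exp (2 * b * q.2.1) *
      (pd i j (k + 1) u q.2.1 q.2.2 q.1 * pd i j (k + 1) u q.2.1 q.2.2 q.1)
      + exp (2 * b * q.2.1) *
      (pd i j k u q.2.1 q.2.2 q.1 * pd i j (k + 2) u q.2.1 q.2.2 q.1)) := by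
    fun_prop
  simp only [sq, ← integral_const_mul]
  refine hasDerivAt_integral_of_integral_abs_le (T := t + 1) (M := max (2 * M₁) (2 * (M₂ + M₃)))
    (μ := volume.restrict (strip B))
    (g := fun τ (p : ℝ × ℝ) => exp (2 * b * p.1) * (pd i j k u p.1 p.2 τ * pd i j k u p.1 p.2 τ))
    (g' := fun τ (p : ℝ × ℝ) => 2 * (exp (2 * b * p.1) *
      (pd i j k u p.1 p.2 τ * pd i j (k + 1) u p.1 p.2 τ)))
    (g'' := fun τ (p : ℝ × ℝ) => 2 * (exp (2 * b * p.1) *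
      (pd i j (k + 1) u p.1 p.2 τ * pd i j (k + 1) u p.1 p.2 τ) + exp (2 * b * p.1) *
      (pd i j k u p.1 p.2 τ * pd i j (k + 2) u p.1 p.2 τ)))
    ?_ ?_ (fun τ p => ?_) (fun τ p => ?_) (fun p => ?_) i0 (fun τ hτ => (i1 τ hτ).const_mul 2)
    (fun τ hτ => ((i2 τ hτ).add (i3 τ hτ)).const_mul 2) (fun τ hτ => ?_) (fun τ hτ => ?_) hT
  · exact Continuous.stronglyMeasurable (by simp only [Function.uncurry_def]; fun_prop)
  · exact hc''.stronglyMeasurable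
  · have h0 := hasDerivAt_pd_t hu.smooth i j k p.1 p.2 τ
    refine ((h0.mul h0).const_mul (exp (2 * b * p.1))).congr_deriv ?_
    ring
  · have h0 := hasDerivAt_pd_t hu.smooth i j k p.1 p.2 τ
    have h1 := hasDerivAt_pd_t hu.smooth i j (k + 1) p.1 p.2 τ
    refine (((h0.mul h1).const_mul (exp (2 * b * p.1))).const_mul 2).congr_deriv ?_
    ring
  · exact hc''.comp (Continuous.prodMk_left p)
  · refine le_max_of_le_left ?_
    simp only [abs_mul (2 : ℝ), abs_two, integral_const_mul]
    exact mul_le_mul_of_nonneg_left (hM₁ τ hτ) zero_le_two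
  · refine le_max_of_le_right ?_
    simp only [abs_mul (2 : ℝ), abs_two, integral_const_mul]
    refine mul_le_mul_of_nonneg_left ?_ zero_le_two
    refine (integral_mono ((i2 τ hτ).add (i3 τ hτ)).abs ((i2 τ hτ).abs.add (i3 τ hτ).abs)
      fun p => abs_add_le _ _).trans ?_
    simp only [Pi.add_apply]
    rw [integral_add (i2 τ hτ).abs (i3 τ hτ).abs]
    exact add_le_add (hM₂ τ hτ) (hM₃ τ hτ)

/-- The equation satisfied by `u_xx`. -/
lemma pde_xx (hu : IsZKBSolution B b u) (x : ℝ) {y t : ℝ} (hy : y ∈ Ioo 0 B) (ht : 0 < t) :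
    pd 2 0 1 u x y t = pd 4 0 0 u x y t - pd 0 0 0 u x y t * pd 3 0 0 u x y t
      - 3 * (pd 1 0 0 u x y t * pd 2 0 0 u x y t) - pd 5 0 0 u x y t - pd 3 2 0 u x y t := by
  have hd := fun i j k x => hasDerivAt_pd_x hu.smooth i j k x y t
  have h0 : ∀ x, pd 0 0 1 u x y t - pd 2 0 0 u x y t + pd 0 0 0 u x y t * pd 1 0 0 u x y t
      + pd 3 0 0 u x y t + pd 1 2 0 u x y t = 0 := fun x => by
    simpa [pd] using hu.pde x y hy t ht
  have h1 : ∀ x, pd 1 0 1 u x y t - pd 3 0 0 u x y t + (pd 1 0 0 u x y t * pd 1 0 0 u x y t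
      + pd 0 0 0 u x y t * pd 2 0 0 u x y t) + pd 4 0 0 u x y t + pd 2 2 0 u x y t = 0 :=
    fun x => (((((hd 0 0 1 x).sub (hd 2 0 0 x)).add ((hd 0 0 0 x).mul (hd 1 0 0 x))).add
      (hd 3 0 0 x)).add (hd 1 2 0 x)).unique
        ((hasDerivAt_const x (0 : ℝ)).congr_of_eventuallyEq (.of_forall h0))
  have h2 := (((((hd 1 0 1 x).sub (hd 3 0 0 x)).add (((hd 1 0 0 x).mul (hd 1 0 0 x)).add
    ((hd 0 0 0 x).mul (hd 2 0 0 x)))).add (hd 4 0 0 x)).add (hd 2 2 0 x)).unique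
        ((hasDerivAt_const x (0 : ℝ)).congr_of_eventuallyEq (.of_forall h1))
  norm_num at h2
  linarith

/-- The equation for `u_xx`, tested against `e^{2bx} u_xx`. -/
lemma integral_weighted_xx_mul_xxt (hu : IsZKBSolution B b u) {t : ℝ} (ht : 0 < t) :
    ∫ p in strip B, exp (2 * b * p.1) * (pd 2 0 0 u p.1 p.2 t * pd 2 0 1 u p.1 p.2 t)
      = (∫ p in strip B, exp (2 * b * p.1) * (pd 2 0 0 u p.1 p.2 t * pd 4 0 0 u p.1 p.2 t))
      - (∫ p in strip B, pd 0 0 0 u p.1 p.2 t *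
          (exp (2 * b * p.1) * (pd 2 0 0 u p.1 p.2 t * pd 3 0 0 u p.1 p.2 t)))
      - 3 * (∫ p in strip B, pd 1 0 0 u p.1 p.2 t *
          (exp (2 * b * p.1) * (pd 2 0 0 u p.1 p.2 t * pd 2 0 0 u p.1 p.2 t)))
      - (∫ p in strip B, exp (2 * b * p.1) * (pd 2 0 0 u p.1 p.2 t * pd 5 0 0 u p.1 p.2 t))
      - (∫ p in strip B, exp (2 * b * p.1) * (pd 2 0 0 u p.1 p.2 t * pd 3 2 0 u p.1 p.2 t)) := by
  have i1 := hu.integrableOn_weighted_mul (i := 2) (j := 0) (k := 0) (i' := 4) (j' := 0)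
    (k' := 0) (by omega) (by omega) ht.le
  have i2 := hu.integrableOn_weighted_mul_mul (l := 0) (m := 0) (n := 0) (i := 2) (j := 0)
    (k := 0) (i' := 3) (j' := 0) (k' := 0) (by omega) (by omega) (by omega) ht.le
  have i3 := hu.integrableOn_weighted_mul_mul (l := 1) (m := 0) (n := 0) (i := 2) (j := 0)
    (k := 0) (i' := 2) (j' := 0) (k' := 0) (by omega) (by omega) (by omega) ht.le
  have i4 := hu.integrableOn_weighted_mul (i := 2) (j := 0) (k := 0) (i' := 5) (j' := 0)
    (k' := 0) (by omega) (by omega) ht.le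
  have i5 := hu.integrableOn_weighted_mul (i := 2) (j := 0) (k := 0) (i' := 3) (j' := 2)
    (k' := 0) (by omega) (by omega) ht.le
  rw [← integral_const_mul, ← integral_sub i1 i2, ← integral_sub (i1.fun_sub i2) (i3.const_mul 3),
    ← integral_sub ((i1.fun_sub i2).fun_sub (i3.const_mul 3)) i4,
    ← integral_sub (((i1.fun_sub i2).fun_sub (i3.const_mul 3)).fun_sub i4) i5]
  refine setIntegral_congr_fun (measurableSet_strip B) fun p hp => ?_
  rw [hu.pde_xx p.1 hp.2 ht]
  ring

end IsZKBSolution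

/-- **Weighted identity (3.26) of the paper (Estimate V)**: for a classical
solution `u` with decay weight `b` and every `t > 0`,
`(d/dt)(e^{2bx},u_xx²)(t) + (2+6b)(e^{2bx},u_xxx²)(t) + 2b(e^{2bx},u_xxy²)(t)
 − (4b²+8b³)(e^{2bx},u_xx²)(t) − 2b(e^{2bx},u u_xx²)(t)
 + 5(e^{2bx},u_x u_xx²)(t) = 0`. -/
theorem zkb_estimate_V_identity (B b : ℝ) (hB : 0 < B) (hb : 0 < b)
    (u : ℝ → ℝ → ℝ → ℝ) (hu : IsZKBSolution B b u) :
    ∀ t : ℝ, 0 < t →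
      deriv (fun τ => ∫ p in strip B, Real.exp (2*b*p.1) * (pd 2 0 0 u p.1 p.2 τ)^2) t
        + (2 + 6*b) * (∫ p in strip B, Real.exp (2*b*p.1) * (pd 3 0 0 u p.1 p.2 t)^2)
        + 2*b * (∫ p in strip B, Real.exp (2*b*p.1) * (pd 2 1 0 u p.1 p.2 t)^2)
        - (4*b^2 + 8*b^3) * (∫ p in strip B, Real.exp (2*b*p.1) * (pd 2 0 0 u p.1 p.2 t)^2)
        - 2*b * (∫ p in strip B,
            Real.exp (2*b*p.1) * u p.1 p.2 t * (pd 2 0 0 u p.1 p.2 t)^2)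
        + 5 * (∫ p in strip B,
            Real.exp (2*b*p.1) * pd 1 0 0 u p.1 p.2 t * (pd 2 0 0 u p.1 p.2 t)^2)
      = 0 := by
  intro t ht
  have hxx := hu.integral_weighted_mul_by_parts_x (i := 2) (j := 0) (k := 0) (i' := 2) (j' := 0)
    (k' := 0) (by omega) (by omega) ht.le
  have hxx_xxx := hu.integral_weighted_mul_by_parts_x (i := 2) (j := 0) (k := 0) (i' := 3)
    (j' := 0) (k' := 0) (by omega) (by omega) ht.le
  have hxxx := hu.integral_weighted_mul_by_parts_x (i := 3) (j := 0) (k := 0) (i' := 3)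
    (j' := 0) (k' := 0) (by omega) (by omega) ht.le
  have hxx_xxxx := hu.integral_weighted_mul_by_parts_x (i := 2) (j := 0) (k := 0) (i' := 4)
    (j' := 0) (k' := 0) (by omega) (by omega) ht.le
  have hxxy := hu.integral_weighted_mul_by_parts_x (i := 2) (j := 1) (k := 0) (i' := 2)
    (j' := 1) (k' := 0) (by omega) (by omega) ht.le
  have hy := hu.integral_weighted_mul_by_parts_y hB (i := 2) (i' := 3) (j' := 1) (k' := 0)
    (by omega) (by omega) ht.le
  have hcubic := hu.integral_weighted_mul_mul_by_parts_x (l := 0) (m := 0) (n := 0) (i := 2)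
    (j := 0) (k := 0) (i' := 2) (j' := 0) (k' := 0) (by omega) (by omega) (by omega) ht.le
  have hpde := hu.integral_weighted_xx_mul_xxt ht
  have comm : ∀ i j k i' j' k', ∫ p in strip B, exp (2 * b * p.1) *
      (pd i j k u p.1 p.2 t * pd i' j' k' u p.1 p.2 t) = ∫ p in strip B, exp (2 * b * p.1) *
      (pd i' j' k' u p.1 p.2 t * pd i j k u p.1 p.2 t) := fun i j k i' j' k' => by
    simp only [mul_comm (pd i j k u _ _ t)]
  have comm' : ∫ p in strip B, pd 0 0 0 u p.1 p.2 t * (exp (2 * b * p.1) *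
      (pd 3 0 0 u p.1 p.2 t * pd 2 0 0 u p.1 p.2 t)) = ∫ p in strip B, pd 0 0 0 u p.1 p.2 t *
      (exp (2 * b * p.1) * (pd 2 0 0 u p.1 p.2 t * pd 3 0 0 u p.1 p.2 t)) := by
    simp only [mul_comm (pd 3 0 0 u _ _ t)]
  have hsq : ∀ i j k, ∫ p in strip B, exp (2 * b * p.1) * (pd i j k u p.1 p.2 t) ^ 2
      = ∫ p in strip B, exp (2 * b * p.1) *
        (pd i j k u p.1 p.2 t * pd i j k u p.1 p.2 t) := fun i j k => by
    simp only [sq]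
  have hcub : ∀ i, ∫ p in strip B,
      exp (2 * b * p.1) * pd i 0 0 u p.1 p.2 t * (pd 2 0 0 u p.1 p.2 t) ^ 2
      = ∫ p in strip B, pd i 0 0 u p.1 p.2 t * (exp (2 * b * p.1) *
        (pd 2 0 0 u p.1 p.2 t * pd 2 0 0 u p.1 p.2 t)) := fun i => by
    refine integral_congr_ae (ae_of_all _ fun p => ?_)
    simp only
    ring
  have hcub0 := hcub 0
  rw [(hu.hasDerivAt_integral_weighted_sq (i := 2) (j := 0) (k := 0) (by omega) ht).deriv, hsq,
    hsq, hsq, hcub 1]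
  change _ - 2 * b * (∫ p in strip B,
    exp (2 * b * p.1) * pd 0 0 0 u p.1 p.2 t * (pd 2 0 0 u p.1 p.2 t) ^ 2) + _ = 0
  norm_num only at *
  rw [comm 3 0 0 2 0 0] at hxx
  rw [comm 4 0 0 3 0 0] at hxxx
  rw [comm 3 1 0 2 1 0] at hxxy
  rw [hcub0, hpde]
  rw [comm'] at hcubic
  linear_combination (2 + 4 * b) * hxx_xxx - (2 * b + 4 * b ^ 2) * hxx - 2 * hxx_xxxx + hxxx
    - 2 * hy + hxxy - hcubic
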